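/- arXiv:2103.08638 — 12 statements merged into one kernel-verified Lean document; each statement's English description precedes it below -/
import Mathlib

section
/- ELLC functions have one-sided bounded Clarke directional derivatives in coordinate directions (Proposition 6): Let f : EuclideanSpace ℝ (Fin n) → ℝ, z₀ : EuclideanSpace ℝ (Fin n), N an open set containing z₀, κ : EuclideanSpace ℝ (Fin n) and ρ : ℝ such that for all z', z'' ∈ N: (f z' - f z'') * ⟪κ, z' - z''⟫_ℝ ≤ ρ * ‖z' - z''‖^2. Fix j : Fin n and let e j denote the j-th standard basis vector (so ‖e j‖ = 1 and ⟪κ, e j⟫_ℝ = κ j). If κ j > 0, then the Clarke upper directional derivative f°(z₀, e j) ≤ (ρ / κ j : EReal); if κ j < 0, then the Clarke lower directional derivative f_○(z₀, e j) ≥ (ρ / κ j : EReal). -/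
open scoped InnerProductSpace

/-- Clarke (generalized) upper directional derivative of `f` at `z` in direction `v`. -/
noncomputable def clarkeUpper {E : Type*} [NormedAddCommGroup E] [NormedSpace ℝ E]
    (f : E → ℝ) (z v : E) : EReal :=
  Filter.limsup
    (fun tl : E × ℝ => (((f (tl.1 + tl.2 • v) - f tl.1) / tl.2 : ℝ) : EReal))
    ((nhds z) ×ˢ (nhdsWithin 0 (Set.Ioi 0)))

/-- Clarke (generalized) lower directional derivative of `f` at `z` in direction `v`. -/
noncomputable def clarkeLower {E : Type*} [NormedAddCommGroup E] [NormedSpace ℝ E]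
    (f : E → ℝ) (z v : E) : EReal :=
  Filter.liminf
    (fun tl : E × ℝ => (((f (tl.1 + tl.2 • v) - f tl.1) / tl.2 : ℝ) : EReal))
    ((nhds z) ×ˢ (nhdsWithin 0 (Set.Ioi 0)))

/-- If `f` satisfies the ELLC inequality with vector `κ` and constant `ρ` near `z`, then its
difference quotients in direction `v`, multiplied by `⟪κ, v⟫`, are eventually at most
`ρ * ‖v‖ ^ 2`. -/
theorem eventually_differenceQuotient_mul_inner_le {E : Type*} [NormedAddCommGroup E]
    [InnerProductSpace ℝ E] {f : E → ℝ} {z κ : E} {N : Set E} {ρ : ℝ} (hN : N ∈ nhds z)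
    (hf : ∀ z' ∈ N, ∀ z'' ∈ N, (f z' - f z'') * ⟪κ, z' - z''⟫_ℝ ≤ ρ * ‖z' - z''‖ ^ 2) (v : E) :
    ∀ᶠ tl : E × ℝ in nhds z ×ˢ nhdsWithin 0 (Set.Ioi 0),
      (f (tl.1 + tl.2 • v) - f tl.1) / tl.2 * ⟪κ, v⟫_ℝ ≤ ρ * ‖v‖ ^ 2 := by
  have hcont : Filter.Tendsto (fun tl : E × ℝ => tl.1 + tl.2 • v)
      (nhds z ×ˢ nhdsWithin 0 (Set.Ioi 0)) (nhds z) := by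
    have h : Continuous fun tl : E × ℝ => tl.1 + tl.2 • v := by fun_prop
    have h0 := h.tendsto (z, 0)
    rw [zero_smul, add_zero, nhds_prod_eq] at h0
    exact h0.mono_left (Filter.prod_mono le_rfl nhdsWithin_le_nhds)
  filter_upwards [hcont.eventually hN, Filter.tendsto_fst.eventually hN,
    Filter.tendsto_snd.eventually self_mem_nhdsWithin] with tl h1 h2 (h3 : 0 < tl.2)
  have h := hf _ h1 _ h2
  rw [add_sub_cancel_left, real_inner_smul_right, norm_smul, mul_pow, Real.norm_eq_abs,
    sq_abs] at h
  rw [div_mul_eq_mul_div, div_le_iff₀ h3]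
  refine le_of_mul_le_mul_right ?_ h3
  linarith

/-- Proposition 6: ELLC functions have one-sided bounded Clarke directional derivatives
in coordinate directions. -/
theorem stmt_1 (n : ℕ) (f : EuclideanSpace ℝ (Fin n) → ℝ)
    (z₀ : EuclideanSpace ℝ (Fin n)) (N : Set (EuclideanSpace ℝ (Fin n)))
    (hN : IsOpen N) (hz₀ : z₀ ∈ N)
    (κ : EuclideanSpace ℝ (Fin n)) (ρ : ℝ)
    (hELLC : ∀ z' ∈ N, ∀ z'' ∈ N,
      (f z' - f z'') * ⟪κ, z' - z''⟫_ℝ ≤ ρ * ‖z' - z''‖ ^ 2)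
    (j : Fin n) :
    (0 < κ j → clarkeUpper f z₀ (EuclideanSpace.single j 1) ≤ ((ρ / κ j : ℝ) : EReal)) ∧
    (κ j < 0 → ((ρ / κ j : ℝ) : EReal) ≤ clarkeLower f z₀ (EuclideanSpace.single j 1)) := by
  have hq := eventually_differenceQuotient_mul_inner_le (hN.mem_nhds hz₀) hELLC
    (EuclideanSpace.single j 1)
  simp only [EuclideanSpace.inner_single_right, PiLp.norm_single, norm_one, one_pow,
    mul_one, one_mul, conj_trivial] at hq
  refine ⟨fun hκ => Filter.limsup_le_of_le (h := ?_), fun hκ => Filter.le_liminf_of_le (h := ?_)⟩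
  · filter_upwards [hq] with tl h
    exact EReal.coe_le_coe_iff.2 ((le_div_iff₀ hκ).2 h)
  · filter_upwards [hq] with tl h
    exact EReal.coe_le_coe_iff.2 ((div_le_iff_of_neg hκ).2 h)
end

section
/- Intersection property of decomposition functions (Corollary 1): Let f : (Fin n → ℝ) → (Fin m → ℝ) and Z ⊆ (Fin n → ℝ). Suppose (f̄¹, f̲¹) and (f̄², f̲²) are both pairs of upper/lower decomposition functions for f on Z. Then the pair (fun a b => fun i => min (f̄¹ a b i) (f̄² a b i), fun a b => fun i => max (f̲¹ a b i) (f̲² a b i)), i.e., the componentwise minimum of the upper functions and the componentwise maximum of the lower functions, is again a pair of upper/lower decomposition functions for f on Z. -/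
/-- A pair `(fu, fl)` of upper/lower decomposition functions for `f` on `Z`:
each is monotone nondecreasing in its first argument and nonincreasing in its
second argument, and they frame `f` on `Z`. -/
def IsDecompPair {n m : ℕ} (f : (Fin n → ℝ) → (Fin m → ℝ)) (Z : Set (Fin n → ℝ))
    (fu fl : (Fin n → ℝ) → (Fin n → ℝ) → (Fin m → ℝ)) : Prop :=
  (∀ a b c, a ≤ b → fu a c ≤ fu b c) ∧
  (∀ a b c, b ≤ c → fu a c ≤ fu a b) ∧
  (∀ a b c, a ≤ b → fl a c ≤ fl b c) ∧
  (∀ a b c, b ≤ c → fl a c ≤ fl a b) ∧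
  (∀ zl ∈ Z, ∀ z ∈ Z, ∀ zu ∈ Z, zl ≤ z → z ≤ zu → fl zl zu ≤ f z ∧ f z ≤ fu zu zl)

/-- Corollary 1 (Intersection property): the componentwise minimum of two upper
decomposition functions and the componentwise maximum of two lower decomposition
functions again form a pair of upper/lower decomposition functions. -/
theorem stmt_3 {n m : ℕ} (f : (Fin n → ℝ) → (Fin m → ℝ)) (Z : Set (Fin n → ℝ))
    (fu₁ fl₁ fu₂ fl₂ : (Fin n → ℝ) → (Fin n → ℝ) → (Fin m → ℝ))
    (h1 : IsDecompPair f Z fu₁ fl₁) (h2 : IsDecompPair f Z fu₂ fl₂) :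
    IsDecompPair f Z
      (fun a b => fun i => min (fu₁ a b i) (fu₂ a b i))
      (fun a b => fun i => max (fl₁ a b i) (fl₂ a b i)) := by
  obtain ⟨hu₁, hu₁', hl₁, hl₁', hf₁⟩ := h1
  obtain ⟨hu₂, hu₂', hl₂, hl₂', hf₂⟩ := h2
  refine ⟨fun a b c h i => min_le_min (hu₁ a b c h i) (hu₂ a b c h i),
    fun a b c h i => min_le_min (hu₁' a b c h i) (hu₂' a b c h i),
    fun a b c h i => max_le_max (hl₁ a b c h i) (hl₂ a b c h i),
    fun a b c h i => max_le_max (hl₁' a b c h i) (hl₂' a b c h i),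
    fun zl hzl z hz zu hzu hle hle' => ?_⟩
  obtain ⟨hlow₁, hup₁⟩ := hf₁ zl hzl z hz zu hzu hle hle'
  obtain ⟨hlow₂, hup₂⟩ := hf₂ zl hzl z hz zu hzu hle hle'
  exact ⟨fun i => max_le (hlow₁ i) (hlow₂ i), fun i => le_min (hup₁ i) (hup₂ i)⟩
end

section
/- State framer property of the generalized embedding system, discrete time (Proposition 3): Let f : (Fin nx → ℝ) → (Fin nw → ℝ) → (Fin nx → ℝ), and let f̄_d, f̲_d be maps taking two arguments in (Fin nx → ℝ) × (Fin nw → ℝ) and returning values in Fin nx → ℝ, satisfying the framer property: for all (a, u), (ξ, ω), (b, v) in (Fin nx → ℝ) × (Fin nw → ℝ) with (a, u) ≤ (ξ, ω) ≤ (b, v) in the componentwise product order, f̲_d (a, u) (b, v) ≤ f ξ ω ≤ f̄_d (b, v) (a, u). Let w̲ ≤ w̄ in Fin nw → ℝ, and let x, x̄, x̲ : ℕ → (Fin nx → ℝ) and w : ℕ → (Fin nw → ℝ) be sequences such that for all t: x (t+1) = f (x t) (w t), w̲ ≤ w t ≤ w̄, x̄ (t+1) = f̄_d (x̄ t, w̄)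 (x̲ t, w̲), x̲ (t+1) = f̲_d (x̲ t, w̲) (x̄ t, w̄), and x̲ 0 ≤ x 0 ≤ x̄ 0. Then for all t : ℕ, x̲ t ≤ x t ≤ x̄ t (componentwise); i.e., the trajectory of the system is framed by the solution of the 2nx-dimensional embedding system. -/
/-- Proposition 3 (State framer property of the generalized embedding system,
discrete time): the trajectory of `x (t+1) = f (x t) (w t)` with `w̲ ≤ w t ≤ w̄`
is framed by the solution of the `2 nx`-dimensional embedding system built from
upper/lower decomposition functions `fu, fl`. -/
theorem stmt_4 {nx nw : ℕ}
    (f : (Fin nx → ℝ) → (Fin nw → ℝ) → (Fin nx → ℝ))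
    (fu fl : ((Fin nx → ℝ) × (Fin nw → ℝ)) → ((Fin nx → ℝ) × (Fin nw → ℝ)) → (Fin nx → ℝ))
    (hframe : ∀ au ξω bv : (Fin nx → ℝ) × (Fin nw → ℝ),
      au ≤ ξω → ξω ≤ bv → fl au bv ≤ f ξω.1 ξω.2 ∧ f ξω.1 ξω.2 ≤ fu bv au)
    (wl wu : Fin nw → ℝ) (hw : wl ≤ wu)
    (x xu xl : ℕ → Fin nx → ℝ) (w : ℕ → Fin nw → ℝ)
    (hx : ∀ t, x (t + 1) = f (x t) (w t))
    (hwt : ∀ t, wl ≤ w t ∧ w t ≤ wu)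
    (hxu : ∀ t, xu (t + 1) = fu (xu t, wu) (xl t, wl))
    (hxl : ∀ t, xl (t + 1) = fl (xl t, wl) (xu t, wu))
    (h0 : xl 0 ≤ x 0 ∧ x 0 ≤ xu 0) :
    ∀ t, xl t ≤ x t ∧ x t ≤ xu t := by
  intro t
  induction t with
  | zero => exact h0
  | succ t ih =>
    rw [hx, hxu, hxl]
    exact hframe (xl t, wl) (x t, w t) (xu t, wu) ⟨ih.1, (hwt t).1⟩ ⟨ih.2, (hwt t).2⟩
end

section
/- Clarke-Jacobian sign-stable functions are coordinatewise monotone and attain their extrema over a box at vertices (Proposition 9): Let p ≤ q in Fin n → ℝ (componentwise), let f : (Fin n → ℝ) → ℝ be continuous on Set.Icc p q, and let σ : Fin n → Bool be such that for every j and every z ∈ Set.Icc p q: if σ j then the Clarke lower directional derivative f_○(z, Pi.single j 1) ≥ (0 : EReal), and if ¬(σ j) then the Clarke upper directional derivative f°(z, Pi.single j 1) ≤ (0 : EReal). Define ζ̄ j := if σ j then q j else p j and ζ̲ j := if σ j then p j else q j. Then: (i) for all z, z' ∈ Set.Icc p q with z ≤ z' and z i = z' i for all i ≠ j, one has f z ≤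 f z' when σ j and f z' ≤ f z when ¬(σ j); and (ii) for every z ∈ Set.Icc p q, f ζ̲ ≤ f z ≤ f ζ̄. -/
open Filter Topology Set

/-- A continuous function on a segment whose forward difference quotients in the direction of
the segment are eventually below every positive number does not increase along the segment. -/
theorem apply_add_smul_le_of_eventually_slope_lt {E : Type*} [NormedAddCommGroup E]
    [NormedSpace ℝ E] {f : E → ℝ} {z v : E} {T : ℝ} (hT : 0 ≤ T)
    (hc : ContinuousOn (fun s : ℝ => f (z + s • v)) (Icc 0 T))
    (h : ∀ s ∈ Ico (0 : ℝ) T, ∀ r > 0, ∀ᶠ l in 𝓝[>] (0 : ℝ),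
      (f (z + s • v + l • v) - f (z + s • v)) / l < r) :
    f (z + T • v) ≤ f z := by
  have key := image_le_of_liminf_slope_right_le_deriv_boundary (B := fun _ => f z)
    (B' := fun _ => 0) hc (by simp) continuousOn_const
    (fun x _ => hasDerivWithinAt_const _ _ _) ?_
  · exact key (right_mem_Icc.2 hT)
  · intro x hx r hr
    have hshift : Tendsto (fun y : ℝ => y - x) (𝓝[>] x) (𝓝[>] 0) := by
      refine tendsto_nhdsWithin_iff.2 ⟨?_, ?_⟩
      · have : Tendsto (fun y : ℝ => y - x) (𝓝 x) (𝓝 (x - x)) :=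
          (continuous_id.sub continuous_const).tendsto x
        rw [sub_self] at this
        exact this.mono_left nhdsWithin_le_nhds
      · filter_upwards [self_mem_nhdsWithin] with y hy
        exact sub_pos.2 (mem_Ioi.1 hy)
    refine ((hshift.eventually (h x hx r hr)).mono fun y hy => ?_).frequently
    rw [slope_def_field]
    rwa [add_assoc, ← add_smul, add_sub_cancel] at hy

/-- If the Clarke upper derivative is nonpositive, the difference quotients with base point
frozen at `z` are eventually below every positive number. -/
theorem eventually_slope_lt_of_clarkeUpper_nonpos {E : Type*} [NormedAddCommGroup E]
    [NormedSpace ℝ E] {f : E → ℝ} {z v : E} (h : clarkeUpper f z v ≤ 0) {r : ℝ} (hr : 0 < r) :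
    ∀ᶠ l in 𝓝[>] (0 : ℝ), (f (z + l • v) - f z) / l < r := by
  have h1 := eventually_lt_of_limsup_lt (h.trans_lt (EReal.coe_pos.2 hr))
  filter_upwards [(tendsto_const_nhds.prodMk tendsto_id).eventually h1] with l hl
  exact EReal.coe_lt_coe_iff.1 hl

/-- If the Clarke lower derivative is nonnegative, the difference quotients with base point
frozen at `z` are eventually above every negative number. -/
theorem eventually_lt_slope_of_clarkeLower_nonneg {E : Type*} [NormedAddCommGroup E]
    [NormedSpace ℝ E] {f : E → ℝ} {z v : E} (h : 0 ≤ clarkeLower f z v) {r : ℝ} (hr : r < 0) :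
    ∀ᶠ l in 𝓝[>] (0 : ℝ), r < (f (z + l • v) - f z) / l := by
  have h1 := eventually_lt_of_lt_liminf ((EReal.coe_neg'.2 hr).trans_le h)
  filter_upwards [(tendsto_const_nhds.prodMk tendsto_id).eventually h1] with l hl
  exact EReal.coe_lt_coe_iff.1 hl

/-- A function that is monotone in each coordinate separately on a box, increasing or decreasing
according to `σ`, is monotone for the orthant order determined by `σ`. -/
theorem le_of_coordinatewise_monotone {ι : Type*} [Finite ι] {p q : ι → ℝ}
    {f : (ι → ℝ) → ℝ} {σ : ι → Bool}
    (hmono : ∀ j : ι, ∀ z z' : ι → ℝ, z ∈ Icc p q → z' ∈ Icc p q →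
      z ≤ z' → (∀ i : ι, i ≠ j → z i = z' i) →
      (σ j = true → f z ≤ f z') ∧ (σ j = false → f z' ≤ f z))
    {x y : ι → ℝ} (hx : x ∈ Icc p q) (hy : y ∈ Icc p q)
    (ht : ∀ j, σ j = true → x j ≤ y j) (hf : ∀ j, σ j = false → y j ≤ x j) :
    f x ≤ f y := by
  classical
  have := Fintype.ofFinite ι
  have hmem : ∀ s : Finset ι, s.piecewise y x ∈ Icc p q := fun s =>
    ⟨s.le_piecewise_of_le_of_le hy.1 hx.1, s.piecewise_le_of_le_of_le hy.2 hx.2⟩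
  have key : ∀ s : Finset ι, f x ≤ f (s.piecewise y x) := by
    intro s
    induction s using Finset.induction_on with
    | empty => simp
    | insert j s hj ih =>
      refine ih.trans ?_
      have hoff : ∀ i, i ≠ j → s.piecewise y x i = (insert j s).piecewise y x i := by
        intro i hi
        rw [Finset.piecewise_insert_of_ne _ _ _ hi]
      have h1 : s.piecewise y x j = x j := Finset.piecewise_eq_of_notMem _ _ _ hj
      have h2 : (insert j s).piecewise y x j = y j :=
        Finset.piecewise_eq_of_mem _ _ _ (Finset.mem_insert_self j s)
      cases hs : σ j with
      | true =>
        refine (hmono j _ _ (hmem s) (hmem _) (fun i => ?_) hoff).1 hs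
        by_cases hi : i = j
        · subst hi
          rw [h1, h2]
          exact ht i hs
        · exact (hoff i hi).le
      | false =>
        refine (hmono j _ _ (hmem _) (hmem s) (fun i => ?_) fun i hi => (hoff i hi).symm).2 hs
        by_cases hi : i = j
        · subst hi
          rw [h1, h2]
          exact hf i hs
        · exact (hoff i hi).ge
  simpa using key Finset.univ

/-- Proposition 9: A Clarke-Jacobian sign-stable continuous function is coordinatewise
monotone on the box and attains its extrema over the box at the vertices determined
by the signs `σ`. -/
theorem stmt_7 {n : ℕ} (p q : Fin n → ℝ) (hpq : p ≤ q)
    (f : (Fin n → ℝ) → ℝ) (hf : ContinuousOn f (Set.Icc p q))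
    (σ : Fin n → Bool)
    (hσ : ∀ j : Fin n, ∀ z ∈ Set.Icc p q,
      (σ j = true → (0 : EReal) ≤ clarkeLower f z (Pi.single j 1)) ∧
      (σ j = false → clarkeUpper f z (Pi.single j 1) ≤ (0 : EReal))) :
    (∀ j : Fin n, ∀ z z' : Fin n → ℝ, z ∈ Set.Icc p q → z' ∈ Set.Icc p q →
      z ≤ z' → (∀ i : Fin n, i ≠ j → z i = z' i) →
      (σ j = true → f z ≤ f z') ∧ (σ j = false → f z' ≤ f z)) ∧
    (∀ z ∈ Set.Icc p q,
      f (fun j => if σ j then p j else q j) ≤ f z ∧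
      f z ≤ f (fun j => if σ j then q j else p j)) := by
  have hmono : ∀ j : Fin n, ∀ z z' : Fin n → ℝ, z ∈ Set.Icc p q → z' ∈ Set.Icc p q →
      z ≤ z' → (∀ i : Fin n, i ≠ j → z i = z' i) →
      (σ j = true → f z ≤ f z') ∧ (σ j = false → f z' ≤ f z) := by
    intro j z z' hz hz' hzz' hoff
    have hT : 0 ≤ z' j - z j := sub_nonneg.2 (hzz' j)
    have hend : z + (z' j - z j) • Pi.single j (1 : ℝ) = z' := by
      ext i
      by_cases hi : i = j
      · subst hi
        simp
      · simp [hi, hoff i hi]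
    have hmem : ∀ s ∈ Icc 0 (z' j - z j), z + s • Pi.single j (1 : ℝ) ∈ Icc p q := by
      intro s hs
      have hv : (0 : Fin n → ℝ) ≤ Pi.single j 1 := Pi.single_nonneg.2 zero_le_one
      refine ⟨hz.1.trans (le_add_of_nonneg_right (smul_nonneg hs.1 hv)), ?_⟩
      refine le_trans ?_ hz'.2
      rw [← hend]
      gcongr
      exact hs.2
    have hcont : ContinuousOn (fun s : ℝ => f (z + s • Pi.single j (1 : ℝ)))
        (Icc 0 (z' j - z j)) :=
      hf.comp (by fun_prop) hmem
    constructor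
    · intro hs
      have := apply_add_smul_le_of_eventually_slope_lt (f := fun x => -f x) hT hcont.neg
        fun s hsT r hr => by
          filter_upwards [eventually_lt_slope_of_clarkeLower_nonneg
            ((hσ j _ (hmem s (Ico_subset_Icc_self hsT))).1 hs) (neg_lt_zero.2 hr)] with l hl
          rw [← neg_sub', neg_div]
          exact neg_lt.1 hl
      rw [hend] at this
      exact neg_le_neg_iff.1 this
    · intro hs
      have := apply_add_smul_le_of_eventually_slope_lt hT hcont fun s hsT r hr =>
        eventually_slope_lt_of_clarkeUpper_nonpos
          ((hσ j _ (hmem s (Ico_subset_Icc_self hsT))).2 hs) hr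
      rwa [hend] at this
  refine ⟨hmono, fun z hz => ⟨?_, ?_⟩⟩
  · refine le_of_coordinatewise_monotone hmono ⟨fun j => ?_, fun j => ?_⟩ hz
      (fun j hj => ?_) fun j hj => ?_
    · dsimp only; split_ifs <;> [exact le_rfl; exact hpq j]
    · dsimp only; split_ifs <;> [exact hpq j; exact le_rfl]
    · simpa [hj] using hz.1 j
    · simpa [hj] using hz.2 j
  · refine le_of_coordinatewise_monotone hmono hz ⟨fun j => ?_, fun j => ?_⟩
      (fun j hj => ?_) fun j hj => ?_
    · dsimp only; split_ifs <;> [exact hpq j; exact le_rfl]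
    · dsimp only; split_ifs <;> [exact le_rfl; exact hpq j]
    · simpa [hj] using hz.2 j
    · simpa [hj] using hz.1 j
end

section
/- Scalar Clarke mean-value increment bound (one-dimensional lemma underlying Proposition 9 and Lemma 3): Let a ≤ b be reals, c : ℝ, and f : ℝ → ℝ continuous on Set.Icc a b. Suppose that for every x ∈ Set.Icc a b, the Clarke lower directional derivative of f at x in the direction 1 satisfies f_○(x, 1) ≥ (c : EReal), where f_○(x, 1) := Filter.liminf (fun tl : ℝ × ℝ => (((f (tl.1 + tl.2) - f tl.1) / tl.2 : ℝ) : EReal)) ((nhds x) ×ˢ (nhdsWithin 0 (Set.Ioi 0))). Then f b - f a ≥ c * (b - a). -/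
open Filter Topology Set in
/-- A strict lower bound on the Clarke lower directional derivative in direction `1` is
eventually a strict lower bound for the right slopes. -/
theorem eventually_lt_slope_of_lt_clarke_liminf {f : ℝ → ℝ} {x r : ℝ}
    (h : (r : EReal) < liminf
      (fun tl : ℝ × ℝ => (((f (tl.1 + tl.2) - f tl.1) / tl.2 : ℝ) : EReal))
      (𝓝 x ×ˢ 𝓝[>] 0)) :
    ∀ᶠ z in 𝓝[>] x, r < slope f x z := by
  have hsub : Tendsto (fun z : ℝ => z - x) (𝓝[>] x) (𝓝[>] 0) := by
    refine tendsto_nhdsWithin_iff.2 ⟨?_, ?_⟩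
    · have : Tendsto (fun z : ℝ => z - x) (𝓝 x) (𝓝 (x - x)) :=
        (continuous_id.sub continuous_const).tendsto x
      rw [sub_self] at this
      exact this.mono_left nhdsWithin_le_nhds
    · filter_upwards [self_mem_nhdsWithin] with z hz
      exact mem_Ioi.2 (sub_pos.2 (mem_Ioi.1 hz))
  have hpair : Tendsto (fun z : ℝ => (x, z - x)) (𝓝[>] x) (𝓝 x ×ˢ 𝓝[>] 0) :=
    tendsto_const_nhds.prodMk hsub
  filter_upwards [hpair.eventually (eventually_lt_of_lt_liminf h)] with z hz
  simpa [slope_def_field] using EReal.coe_lt_coe_iff.1 hz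

/-- Scalar Clarke mean-value increment bound: if the Clarke lower directional
derivative of a continuous `f : ℝ → ℝ` in direction `1` is at least `c` on
`[a, b]`, then `f b - f a ≥ c * (b - a)`. -/
theorem stmt_8 (a b c : ℝ) (hab : a ≤ b) (f : ℝ → ℝ)
    (hf : ContinuousOn f (Set.Icc a b))
    (hc : ∀ x ∈ Set.Icc a b,
      (c : EReal) ≤ Filter.liminf
        (fun tl : ℝ × ℝ => (((f (tl.1 + tl.2) - f tl.1) / tl.2 : ℝ) : EReal))
        ((nhds x) ×ˢ (nhdsWithin 0 (Set.Ioi 0)))) :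
    c * (b - a) ≤ f b - f a := by
  have key := image_le_of_liminf_slope_right_le_deriv_boundary
    (f := fun x => -f x) (B := fun x => -f a + -c * (x - a)) (B' := fun _ => -c)
    hf.neg (by simp) (by fun_prop)
    (fun x _ => by
      simpa using ((((hasDerivAt_id x).sub_const a).const_mul (-c)).const_add
        (-f a)).hasDerivWithinAt)
    (fun x hx r hr => by
      have hlt : ((-r : ℝ) : EReal) < c := EReal.coe_lt_coe_iff.2 (by linarith)
      refine ((eventually_lt_slope_of_lt_clarke_liminf
        (hlt.trans_le (hc x (Set.Ico_subset_Icc_self hx)))).mono fun z hz => ?_).frequently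
      have hneg : slope (fun x => -f x) x z = -slope f x z := by
        simp only [slope_def_field]
        ring
      linarith)
    (Set.right_mem_Icc.2 hab)
  linarith
end

section
/- Alignment of the remainder decomposition (Lemma 1): Let Z ⊆ (Fin n → ℝ), let f, h : (Fin n → ℝ) → ℝ, fix j : Fin n, and write e j := Pi.single j 1. (i) Suppose b : ℝ is such that for all z ∈ Z the Clarke upper directional derivative f°(z, e j) ≤ (b : EReal) and the Clarke lower directional derivative h_○(z, e j) ≥ (max b 0 : EReal), and that f and h are Lipschitz on a neighborhood of each point of Z. Then for all z ∈ Z, (f - h)°(z, e j) ≤ (0 : EReal) and h_○(z, e j) ≥ (0 : EReal). (ii) Dually, suppose a : ℝ is such that for all z ∈ Z, f_○(z, e j) ≥ (a : EReal) and h°(z, e j) ≤ (min a 0 : EReal), with the same local Lipschitz hypothesis. Then for all z ∈ Z, (f - h)_○(z, e j) ≥ (0 : EReal) and h°(z, e j) ≤ (0 : EReal). In other words, h is Clarke Jacobian sign-stable, g := f - h is Clarke Jacobian sign-stable, and the pair (g, -h) is aligned: in each coordinate the signs of their Clarke derivative bounds are opposite. -/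
theorem EReal.limsup_coe_sub_nonpos {α : Type*} {l : Filter α} {u v : α → ℝ} {b : ℝ}
    (hu : Filter.limsup (fun x => (u x : EReal)) l ≤ b)
    (hv : (b : EReal) ≤ Filter.liminf (fun x => (v x : EReal)) l) :
    Filter.limsup (fun x => ((u x - v x : ℝ) : EReal)) l ≤ 0 := by
  have hneg : Filter.limsup (-fun x => (v x : EReal)) l ≤ ((-b : ℝ) : EReal) := by
    rw [EReal.limsup_neg, EReal.coe_neg]
    exact EReal.neg_le_neg_iff.2 hv
  have hadd : (fun x => ((u x - v x : ℝ) : EReal)) =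
      (fun x => (u x : EReal)) + -fun x => (v x : EReal) := by
    funext x
    simp [sub_eq_add_neg]
  rw [hadd]
  calc
    _ ≤ _ := EReal.limsup_add_le (.inr (hneg.trans_lt (EReal.coe_lt_top _)).ne)
      (.inl (hu.trans_lt (EReal.coe_lt_top _)).ne)
    _ ≤ (b : EReal) + ((-b : ℝ) : EReal) := add_le_add hu hneg
    _ = 0 := by rw [← EReal.coe_add, add_neg_cancel, EReal.coe_zero]

theorem EReal.liminf_coe_sub_nonneg {α : Type*} {l : Filter α} {u v : α → ℝ} {a : ℝ}
    (hu : (a : EReal) ≤ Filter.liminf (fun x => (u x : EReal)) l)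
    (hv : Filter.limsup (fun x => (v x : EReal)) l ≤ a) :
    0 ≤ Filter.liminf (fun x => ((u x - v x : ℝ) : EReal)) l := by
  have hneg : (fun x => ((u x - v x : ℝ) : EReal)) =
      -fun x => ((v x - u x : ℝ) : EReal) := by
    funext x
    rw [Pi.neg_apply, ← EReal.coe_neg, _root_.neg_sub]
  rw [hneg, EReal.liminf_neg, EReal.le_neg, neg_zero]
  exact EReal.limsup_coe_sub_nonpos hv hu

theorem clarkeUpper_sub_nonpos {E : Type*} [NormedAddCommGroup E] [NormedSpace ℝ E]
    {f h : E → ℝ} {z v : E} {b : ℝ} (hf : clarkeUpper f z v ≤ b)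
    (hh : (b : EReal) ≤ clarkeLower h z v) : clarkeUpper (fun x => f x - h x) z v ≤ 0 := by
  have key := EReal.limsup_coe_sub_nonpos hf hh
  simp only [← sub_div] at key
  simp only [clarkeUpper]
  convert key using 5
  ring

theorem clarkeLower_sub_nonneg {E : Type*} [NormedAddCommGroup E] [NormedSpace ℝ E]
    {f h : E → ℝ} {z v : E} {a : ℝ} (hf : (a : EReal) ≤ clarkeLower f z v)
    (hh : clarkeUpper h z v ≤ a) : 0 ≤ clarkeLower (fun x => f x - h x) z v := by
  have key := EReal.liminf_coe_sub_nonneg hf hh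
  simp only [← sub_div] at key
  simp only [clarkeLower]
  convert key using 5
  ring

/-- Lemma 1 (Alignment of the remainder decomposition): if the Clarke derivative of
`f` in the coordinate direction `e j` is bounded by `b` from above and the remainder
`h` has Clarke lower derivative at least `max b 0`, then `g = f - h` has nonpositive
Clarke upper derivative while `h` has nonnegative Clarke lower derivative in that
direction; and dually. -/
theorem stmt_9 {n : ℕ} (Z : Set (Fin n → ℝ)) (f h : (Fin n → ℝ) → ℝ) (j : Fin n)
    (hLip : ∀ z ∈ Z, ∃ U : Set (Fin n → ℝ), IsOpen U ∧ z ∈ U ∧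
      ∃ Lf Lh : NNReal, LipschitzOnWith Lf f U ∧ LipschitzOnWith Lh h U) :
    (∀ b : ℝ,
      (∀ z ∈ Z, clarkeUpper f z (Pi.single j 1) ≤ (b : EReal)) →
      (∀ z ∈ Z, ((max b 0 : ℝ) : EReal) ≤ clarkeLower h z (Pi.single j 1)) →
      ∀ z ∈ Z, clarkeUpper (fun x => f x - h x) z (Pi.single j 1) ≤ (0 : EReal) ∧
        (0 : EReal) ≤ clarkeLower h z (Pi.single j 1)) ∧
    (∀ a : ℝ,
      (∀ z ∈ Z, ((a : ℝ) : EReal) ≤ clarkeLower f z (Pi.single j 1)) →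
      (∀ z ∈ Z, clarkeUpper h z (Pi.single j 1) ≤ ((min a 0 : ℝ) : EReal)) →
      ∀ z ∈ Z, (0 : EReal) ≤ clarkeLower (fun x => f x - h x) z (Pi.single j 1) ∧
        clarkeUpper h z (Pi.single j 1) ≤ (0 : EReal)) := by
  refine ⟨fun b hf hh z hz => ⟨?_, ?_⟩, fun a hf hh z hz => ⟨?_, ?_⟩⟩
  · exact clarkeUpper_sub_nonpos (hf z hz)
      ((EReal.coe_le_coe_iff.2 (le_max_left b 0)).trans (hh z hz))
  · exact (EReal.coe_le_coe_iff.2 (le_max_right b 0)).trans (hh z hz)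
  · exact clarkeLower_sub_nonneg (hf z hz)
      ((hh z hz).trans (EReal.coe_le_coe_iff.2 (min_le_left a 0)))
  · exact (hh z hz).trans (EReal.coe_le_coe_iff.2 (min_le_right a 0))
end

section
/- The remainder-form functions are mixed-monotone decomposition functions (Theorem 1, discrete-time case): Let p ≤ q in Fin n → ℝ (componentwise), let f, h : (Fin n → ℝ) → ℝ be continuous on Set.Icc p q, let S ⊆ Fin n, and suppose there are reals b j (for j ∈ S) and a j (for j ∉ S) such that for every z ∈ Set.Icc p q: for j ∈ S, the Clarke upper directional derivative f°(z, Pi.single j 1) ≤ (b j : EReal) and the Clarke lower directional derivative h_○(z, Pi.single j 1) ≥ (max (b j) 0 : EReal); and for j ∉ S, f_○(z, Pi.single j 1) ≥ (a j : EReal) and h°(z, Pi.single j 1) ≤ (min (a j) 0 : EReal). Define ζ : (Fin n → ℝ) → (Fin n → ℝ) → (Fin n → ℝ) by (ζ z ẑ) j := if j ∈ S then ẑ j else z j, and define the remainder-form function f_d z ẑ := h (ζ ẑ z) + f (ζ z ẑ) - h (ζ z ẑ). Then: (i) f_d z z = f z for all z; (ii) for all z, z', ẑ ∈ Set.Icc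 p q with z ≤ z', f_d z ẑ ≤ f_d z' ẑ; (iii) for all z, ẑ, ẑ' ∈ Set.Icc p q with ẑ ≤ ẑ', f_d z ẑ' ≤ f_d z ẑ; and consequently (iv) for all z̲, z, z̄ ∈ Set.Icc p q with z̲ ≤ z ≤ z̄, f_d z̲ z̄ ≤ f z ≤ f_d z̄ z̲. -/
open Filter Topology

theorem eventually_quotient_lt_of_clarkeUpper_le {E : Type*} [NormedAddCommGroup E]
    [NormedSpace ℝ E] {g : E → ℝ} {z v : E} {c r : ℝ}
    (hg : clarkeUpper g z v ≤ (c : EReal)) (hr : c < r) :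
    ∀ᶠ l in 𝓝[>] (0 : ℝ), (g (z + l • v) - g z) / l < r := by
  have hev := eventually_lt_of_limsup_lt (hg.trans_lt (EReal.coe_lt_coe_iff.2 hr))
  have ht : Tendsto (fun l : ℝ => (z, l)) (𝓝[>] 0) (𝓝 z ×ˢ 𝓝[>] (0 : ℝ)) :=
    tendsto_const_nhds.prodMk tendsto_id
  filter_upwards [ht.eventually hev] with l hl
  exact EReal.coe_lt_coe_iff.1 hl

theorem eventually_lt_quotient_of_le_clarkeLower {E : Type*} [NormedAddCommGroup E]
    [NormedSpace ℝ E] {g : E → ℝ} {z v : E} {c r : ℝ}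
    (hg : (c : EReal) ≤ clarkeLower g z v) (hr : r < c) :
    ∀ᶠ l in 𝓝[>] (0 : ℝ), r < (g (z + l • v) - g z) / l := by
  have hev := eventually_lt_of_lt_liminf ((EReal.coe_lt_coe_iff.2 hr).trans_le hg)
  have ht : Tendsto (fun l : ℝ => (z, l)) (𝓝[>] 0) (𝓝 z ×ˢ 𝓝[>] (0 : ℝ)) :=
    tendsto_const_nhds.prodMk tendsto_id
  filter_upwards [ht.eventually hev] with l hl
  exact EReal.coe_lt_coe_iff.1 hl

/-- If the Clarke upper derivative of `u` does not exceed the Clarke lower derivative of `w`,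
then the upper right Dini derivative of `u - w` is nonpositive. -/
theorem eventually_quotient_sub_lt {E : Type*} [NormedAddCommGroup E] [NormedSpace ℝ E]
    {u w : E → ℝ} {z v : E} {c d r : ℝ} (hu : clarkeUpper u z v ≤ (c : EReal))
    (hw : (d : EReal) ≤ clarkeLower w z v) (hcd : c ≤ d) (hr : 0 < r) :
    ∀ᶠ l in 𝓝[>] (0 : ℝ), ((u - w) (z + l • v) - (u - w) z) / l < r := by
  filter_upwards [eventually_quotient_lt_of_clarkeUpper_le hu (r := c + r / 2) (by linarith),
    eventually_lt_quotient_of_le_clarkeLower hw (r := d - r / 2) (by linarith)] with l h1 h2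
  have : ((u - w) (z + l • v) - (u - w) z) / l
      = (u (z + l • v) - u z) / l - (w (z + l • v) - w z) / l := by
    simp only [Pi.sub_apply]
    ring
  linarith

section Box

variable {ι : Type*} [DecidableEq ι] {p q : ι → ℝ} {g : (ι → ℝ) → ℝ}

/-- A continuous function on a box whose upper right Dini derivative in the `j`-th coordinate is
nonpositive does not increase when the `j`-th coordinate does. -/
theorem apply_update_le_of_quotient_lt {j : ι} (hg : ContinuousOn g (Set.Icc p q))
    (hj : ∀ z ∈ Set.Icc p q, ∀ r > 0,
      ∀ᶠ l in 𝓝[>] (0 : ℝ), (g (z + l • Pi.single j 1) - g z) / l < r)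
    {z : ι → ℝ} (hz : z ∈ Set.Icc p q) {t : ℝ} (hzt : z j ≤ t) (htq : t ≤ q j) :
    g (Function.update z j t) ≤ g z := by
  have hmem : ∀ s ∈ Set.Icc (z j) t, Function.update z j s ∈ Set.Icc p q := fun s hs =>
    ⟨le_update_iff.2 ⟨(hz.1 j).trans hs.1, fun i _ => hz.1 i⟩,
      update_le_iff.2 ⟨hs.2.trans htq, fun i _ => hz.2 i⟩⟩
  have hcont : ContinuousOn (fun s => g (Function.update z j s)) (Set.Icc (z j) t) :=
    hg.comp (by fun_prop) hmem
  have key := image_le_of_liminf_slope_right_le_deriv_boundary (a := z j) (b := t)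
    (B := fun _ => g z) (B' := fun _ => 0) hcont (by simp) continuousOn_const
    (fun x _ => hasDerivWithinAt_const x _ _) (fun s hs r hr => ?_)
  · exact key (Set.right_mem_Icc.2 hzt)
  · have ht : Tendsto (fun s' => s' - s) (𝓝[>] s) (𝓝[>] 0) := by
      refine tendsto_nhdsWithin_iff.2 ⟨?_, ?_⟩
      · have : ContinuousAt (fun s' : ℝ => s' - s) s := by fun_prop
        simpa using this.tendsto.mono_left nhdsWithin_le_nhds
      · filter_upwards [self_mem_nhdsWithin] with s' hs'
        exact Set.mem_Ioi.2 (sub_pos.2 (Set.mem_Ioi.1 hs'))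
    refine Eventually.frequently ?_
    filter_upwards [ht.eventually (hj _ (hmem s (Set.Ico_subset_Icc_self hs)) r hr)] with s' hs'
    have hupd : Function.update z j s + (s' - s) • Pi.single j 1 = Function.update z j s' := by
      ext i
      rcases eq_or_ne i j with rfl | hij
      · simp
      · simp [hij]
    rw [hupd] at hs'
    rwa [slope_def_field]

/-- A continuous function on a box whose upper right Dini derivatives are nonpositive in all
coordinates in which `x ≤ y` differ satisfies `g y ≤ g x`. -/
theorem apply_le_apply_of_quotient_lt [Fintype ι] (hg : ContinuousOn g (Set.Icc p q)) {x y : ι → ℝ}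
    (hx : x ∈ Set.Icc p q) (hy : y ∈ Set.Icc p q) (hxy : x ≤ y)
    (hj : ∀ j, x j ≠ y j → ∀ z ∈ Set.Icc p q, ∀ r > 0,
      ∀ᶠ l in 𝓝[>] (0 : ℝ), (g (z + l • Pi.single j 1) - g z) / l < r) :
    g y ≤ g x := by
  suffices H : ∀ s : Finset ι, g (s.piecewise y x) ≤ g x by
    simpa using H Finset.univ
  intro s
  induction s using Finset.induction_on with
  | empty => simp
  | insert j s hjs ih =>
    rw [Finset.piecewise_insert]
    have hsj : s.piecewise y x j = x j := Finset.piecewise_eq_of_notMem _ _ _ hjs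
    by_cases hne : x j = y j
    · rwa [← hne, ← hsj, Function.update_eq_self]
    · have hmem : s.piecewise y x ∈ Set.Icc p q :=
        ⟨Finset.le_piecewise_of_le_of_le s hy.1 hx.1, Finset.piecewise_le_of_le_of_le s hy.2 hx.2⟩
      exact (apply_update_le_of_quotient_lt hg (hj j hne) hmem
        (hsj.le.trans (hxy j)) (hy.2 j)).trans ih

end Box

/-- Theorem 1 (discrete-time case): the remainder-form function
`f_d z ẑ = h (ζ ẑ z) + f (ζ z ẑ) - h (ζ z ẑ)` is a mixed-monotone decomposition
function for `f`: it agrees with `f` on the diagonal, is nondecreasing in its first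
argument, nonincreasing in its second argument, and frames `f` on the box. -/
theorem stmt_10 {n : ℕ} (p q : Fin n → ℝ) (hpq : p ≤ q)
    (f h : (Fin n → ℝ) → ℝ)
    (hfc : ContinuousOn f (Set.Icc p q)) (hhc : ContinuousOn h (Set.Icc p q))
    (S : Set (Fin n)) [DecidablePred (· ∈ S)] (b a : Fin n → ℝ)
    (hbS : ∀ j ∈ S, ∀ z ∈ Set.Icc p q,
      clarkeUpper f z (Pi.single j 1) ≤ (b j : EReal) ∧
      ((max (b j) 0 : ℝ) : EReal) ≤ clarkeLower h z (Pi.single j 1))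
    (haS : ∀ j ∉ S, ∀ z ∈ Set.Icc p q,
      ((a j : ℝ) : EReal) ≤ clarkeLower f z (Pi.single j 1) ∧
      clarkeUpper h z (Pi.single j 1) ≤ ((min (a j) 0 : ℝ) : EReal)) :
    let ζ : (Fin n → ℝ) → (Fin n → ℝ) → (Fin n → ℝ) :=
      fun z zh => fun j => if j ∈ S then zh j else z j
    let fd : (Fin n → ℝ) → (Fin n → ℝ) → ℝ :=
      fun z zh => h (ζ zh z) + f (ζ z zh) - h (ζ z zh)
    (∀ z, fd z z = f z) ∧
    (∀ z z' zh, z ∈ Set.Icc p q → z' ∈ Set.Icc p q → zh ∈ Set.Icc p q →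
      z ≤ z' → fd z zh ≤ fd z' zh) ∧
    (∀ z zh zh', z ∈ Set.Icc p q → zh ∈ Set.Icc p q → zh' ∈ Set.Icc p q →
      zh ≤ zh' → fd z zh' ≤ fd z zh) ∧
    (∀ zl z zu, zl ∈ Set.Icc p q → z ∈ Set.Icc p q → zu ∈ Set.Icc p q →
      zl ≤ z → z ≤ zu → fd zl zu ≤ f z ∧ f z ≤ fd zu zl) := by
  intro ζ fd
  have hζ : ∀ x y, x ∈ Set.Icc p q → y ∈ Set.Icc p q → ζ x y ∈ Set.Icc p q := by
    refine fun x y hx hy => ⟨fun j => ?_, fun j => ?_⟩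
    · by_cases hj : j ∈ S
      · simpa [ζ, hj] using hy.1 j
      · simpa [ζ, hj] using hx.1 j
    · by_cases hj : j ∈ S
      · simpa [ζ, hj] using hy.2 j
      · simpa [ζ, hj] using hx.2 j
  have hζ_left : ∀ {x x'} y, x ≤ x' → ζ x y ≤ ζ x' y := by
    intro x x' y hx j
    by_cases hj : j ∈ S
    · simp [ζ, hj]
    · simpa [ζ, hj] using hx j
  have hζ_right : ∀ x {y y'}, y ≤ y' → ζ x y ≤ ζ x y' := by
    intro x y y' hy j
    by_cases hj : j ∈ S
    · simpa [ζ, hj] using hy j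
    · simp [ζ, hj]
  have hne_left : ∀ {x x' y j}, ζ x y j ≠ ζ x' y j → j ∉ S :=
    fun hne hj => hne (by simp [ζ, hj])
  have hne_right : ∀ {x y y' j}, ζ x y j ≠ ζ x y' j → j ∈ S :=
    fun hne => by_contra fun hj => hne (by simp [ζ, hj])
  have hdiag : ∀ z, fd z z = f z := fun z => by simp [fd, ζ]
  have hmono : ∀ z z' zh, z ∈ Set.Icc p q → z' ∈ Set.Icc p q → zh ∈ Set.Icc p q →
      z ≤ z' → fd z zh ≤ fd z' zh := by
    intro z z' zh hz hz' hzh hle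
    have h1 := apply_le_apply_of_quotient_lt hhc.neg (hζ zh z hzh hz) (hζ zh z' hzh hz')
      (hζ_right zh hle) fun j hne x hx r hr => by
        filter_upwards [eventually_lt_quotient_of_le_clarkeLower
          (hbS j (hne_right hne) x hx).2 (r := -r)
          ((neg_neg_of_pos hr).trans_le (le_max_right _ _))] with l hl
        have : ((-h) (x + l • Pi.single j 1) - (-h) x) / l
            = -((h (x + l • Pi.single j 1) - h x) / l) := by
          simp only [Pi.neg_apply]
          ring
        linarith
    have h2 := apply_le_apply_of_quotient_lt (hhc.sub hfc) (hζ z zh hz hzh) (hζ z' zh hz' hzh)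
      (hζ_left zh hle) fun j hne x hx r hr =>
        eventually_quotient_sub_lt (haS j (hne_left hne) x hx).2 (haS j (hne_left hne) x hx).1
          (min_le_left _ _) hr
    simp only [fd, Pi.neg_apply, Pi.sub_apply] at h1 h2 ⊢
    linarith
  have hanti : ∀ z zh zh', z ∈ Set.Icc p q → zh ∈ Set.Icc p q → zh' ∈ Set.Icc p q →
      zh ≤ zh' → fd z zh' ≤ fd z zh := by
    intro z zh zh' hz hzh hzh' hle
    have h1 := apply_le_apply_of_quotient_lt hhc (hζ zh z hzh hz) (hζ zh' z hzh' hz)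
      (hζ_left z hle) fun j hne x hx r hr =>
        eventually_quotient_lt_of_clarkeUpper_le (haS j (hne_left hne) x hx).2
          ((min_le_right (a j) 0).trans_lt hr)
    have h2 := apply_le_apply_of_quotient_lt (hfc.sub hhc) (hζ z zh hz hzh) (hζ z zh' hz hzh')
      (hζ_right z hle) fun j hne x hx r hr =>
        eventually_quotient_sub_lt (hbS j (hne_right hne) x hx).1 (hbS j (hne_right hne) x hx).2
          (le_max_left _ _) hr
    simp only [fd, Pi.sub_apply] at h2 ⊢
    linarith
  refine ⟨hdiag, hmono, hanti, fun zl z zu hl hz hu hlz hzu => ?_⟩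
  rw [← hdiag z]
  exact ⟨(hmono _ _ _ hl hz hu hlz).trans (hanti _ _ _ hz hz hu hzu),
    (hmono _ _ _ hz hu hz hzu).trans (hanti _ _ _ hu hl hz hlz)⟩
end

section
/- Upper error bounds for the remainder-form inclusion (Theorem 3, part (ii)): Under the hypotheses: p ≤ q in Fin n → ℝ, f : (Fin n → ℝ) → ℝ continuous on Set.Icc p q, m : Fin n → ℝ, S ⊆ Fin n with m j ≥ 0 for j ∈ S and m j ≤ 0 for j ∉ S, and for every z ∈ Set.Icc p q: f°(z, Pi.single j 1) ≤ (m j : EReal) for j ∈ S and f_○(z, Pi.single j 1) ≥ (m j : EReal) for j ∉ S; define ζ⁺ j := if j ∈ S then p j else q j, ζ⁻ j := if j ∈ S then q j else p j, Δ := ∑ j, m j * (ζ⁻ j - ζ⁺ j), the upper bound f̄ := f ζ⁺ + Δ, and the lower bound f̲ := f ζ⁻ - Δ. Then: (i) 0 ≤ Δ; (ii) 0 ≤ f̄ - sSup (f '' Set.Icc p q) ≤ min Δ (Δ + (f ζ⁺ - f ζ⁻)); and (iii) 0 ≤ sInf (f '' Set.Icc p q) - f̲ ≤ min Δ (Δ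 + (f ζ⁺ - f ζ⁻)). Hence the Hausdorff distance between the remainder-form interval [f̲, f̄] and the tightest enclosing interval [inf f, sup f] of the image of f over the box is at most min Δ (Δ + (f ζ⁺ - f ζ⁻)). -/
open Filter Topology in
/-- Mean value inequality: an upper bound on the Clarke upper directional derivative along a
segment bounds the increment of the function over that segment. -/
theorem sub_le_mul_of_clarkeUpper_le {E : Type*} [NormedAddCommGroup E] [NormedSpace ℝ E]
    {f : E → ℝ} {x v : E} {c T : ℝ} (hT : 0 ≤ T)
    (hf : ContinuousOn (fun s : ℝ => f (x + s • v)) (Set.Icc 0 T))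
    (hc : ∀ s ∈ Set.Icc 0 T, clarkeUpper f (x + s • v) v ≤ (c : EReal)) :
    f (x + T • v) - f x ≤ c * T := by
  have key := image_le_of_liminf_slope_right_le_deriv_boundary
    (B := fun s => f x + c * s) (B' := fun _ => c) hf (by simp) (by fun_prop)
    (fun s _ => (by
      simpa using (((hasDerivAt_id s).const_mul c).const_add (f x)).hasDerivWithinAt))
    (fun s hs r hr => by
      have hlt : clarkeUpper f (x + s • v) v < (r : EReal) :=
        (hc s ⟨hs.1, hs.2.le⟩).trans_lt (EReal.coe_lt_coe_iff.2 hr)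
      have hev := eventually_lt_of_limsup_lt hlt
      have ht : Tendsto (fun u : ℝ => (x + s • v, u - s)) (𝓝[>] s)
          (𝓝 (x + s • v) ×ˢ 𝓝[>] (0 : ℝ)) := by
        refine Tendsto.prodMk tendsto_const_nhds ?_
        refine tendsto_nhdsWithin_of_tendsto_nhds_of_eventually_within _ ?_ ?_
        · have h : Tendsto (fun u : ℝ => u - s) (𝓝 s) (𝓝 (s - s)) :=
            (continuous_id.sub continuous_const).tendsto s
          rw [sub_self] at h
          exact h.mono_left nhdsWithin_le_nhds
        · filter_upwards [self_mem_nhdsWithin] with u hu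
          exact Set.mem_Ioi.2 (sub_pos.2 (Set.mem_Ioi.1 hu))
      refine ((ht.eventually hev).mono fun u hu => ?_).frequently
      rw [EReal.coe_lt_coe_iff] at hu
      have hpt : x + s • v + (u - s) • v = x + u • v := by rw [sub_smul]; abel
      rw [hpt] at hu
      rwa [slope_def_field])
  have := key (Set.right_mem_Icc.2 hT)
  linarith

theorem clarkeUpper_neg {E : Type*} [NormedAddCommGroup E] [NormedSpace ℝ E]
    (f : E → ℝ) (z v : E) : clarkeUpper (-f) z v = -clarkeLower f z v := by
  unfold clarkeUpper clarkeLower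
  rw [← EReal.limsup_neg]
  congr 1
  funext tl
  simp only [Pi.neg_apply]
  rw [← EReal.coe_neg]
  congr 1
  ring

theorem mul_le_sub_of_le_clarkeLower {E : Type*} [NormedAddCommGroup E] [NormedSpace ℝ E]
    {f : E → ℝ} {x v : E} {c T : ℝ} (hT : 0 ≤ T)
    (hf : ContinuousOn (fun s : ℝ => f (x + s • v)) (Set.Icc 0 T))
    (hc : ∀ s ∈ Set.Icc 0 T, (c : EReal) ≤ clarkeLower f (x + s • v) v) :
    c * T ≤ f (x + T • v) - f x := by
  have h := sub_le_mul_of_clarkeUpper_le (f := -f) (c := -c) hT hf.neg fun s hs => by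
    rw [clarkeUpper_neg, EReal.coe_neg]
    exact EReal.neg_le_neg_iff.2 (hc s hs)
  simp only [Pi.neg_apply] at h
  linarith

section Box

variable {ι : Type*} [DecidableEq ι]

theorem update_mem_Icc {p q z : ι → ℝ} (hz : z ∈ Set.Icc p q) {j : ι} {t : ℝ}
    (ht : t ∈ Set.Icc (p j) (q j)) : Function.update z j t ∈ Set.Icc p q :=
  ⟨le_update_iff.2 ⟨ht.1, fun i _ => hz.1 i⟩, update_le_iff.2 ⟨ht.2, fun i _ => hz.2 i⟩⟩

theorem add_smul_single_eq_update (z : ι → ℝ) (j : ι) (s : ℝ) :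
    z + s • Pi.single j (1 : ℝ) = Function.update z j (z j + s) := by
  ext i
  rcases eq_or_ne i j with rfl | h <;> simp [*]

theorem add_smul_single_mem_Icc {p q z : ι → ℝ} (hz : z ∈ Set.Icc p q) {j : ι} {s T : ℝ}
    (hT : z j + T ≤ q j) (hs : s ∈ Set.Icc 0 T) :
    z + s • Pi.single j (1 : ℝ) ∈ Set.Icc p q := by
  rw [add_smul_single_eq_update]
  exact update_mem_Icc hz ⟨by linarith [hz.1 j, hs.1], by linarith [hs.2]⟩

theorem ContinuousOn.comp_add_smul_single {p q z : ι → ℝ} {f : (ι → ℝ) → ℝ}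
    (hf : ContinuousOn f (Set.Icc p q)) (hz : z ∈ Set.Icc p q) {j : ι} {T : ℝ}
    (hT : z j + T ≤ q j) :
    ContinuousOn (fun s : ℝ => f (z + s • Pi.single j (1 : ℝ))) (Set.Icc 0 T) :=
  hf.comp (by fun_prop) fun _ hs => add_smul_single_mem_Icc hz hT hs

variable [Fintype ι] {p q : ι → ℝ} {f : (ι → ℝ) → ℝ} {m : ι → ℝ} {S : Set ι}

/-- Increment bound when a single coordinate moves in its prescribed direction. -/
theorem update_sub_le_mul (hfc : ContinuousOn f (Set.Icc p q))
    (hup : ∀ j ∈ S, ∀ z ∈ Set.Icc p q, clarkeUpper f z (Pi.single j 1) ≤ ((m j : ℝ) : EReal))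
    (hlo : ∀ j ∉ S, ∀ z ∈ Set.Icc p q, ((m j : ℝ) : EReal) ≤ clarkeLower f z (Pi.single j 1))
    {z : ι → ℝ} (hz : z ∈ Set.Icc p q) {j : ι} {t : ℝ} (ht : t ∈ Set.Icc (p j) (q j))
    (hS : j ∈ S → z j ≤ t) (hS' : j ∉ S → t ≤ z j) :
    f (Function.update z j t) - f z ≤ m j * (t - z j) := by
  by_cases hj : j ∈ S
  · have hT : z j + (t - z j) ≤ q j := by linarith [ht.2]
    have h := sub_le_mul_of_clarkeUpper_le (sub_nonneg.2 (hS hj))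
      (hfc.comp_add_smul_single hz hT)
      fun s hs => hup j hj _ (add_smul_single_mem_Icc hz hT hs)
    rwa [add_smul_single_eq_update, add_sub_cancel] at h
  · set w := Function.update z j t with hw
    have hwj : w j = t := Function.update_self ..
    have hwmem : w ∈ Set.Icc p q := update_mem_Icc hz ht
    have hT : w j + (z j - t) ≤ q j := by linarith [hz.2 j]
    have h := mul_le_sub_of_le_clarkeLower (sub_nonneg.2 (hS' hj))
      (hfc.comp_add_smul_single hwmem hT)
      fun s hs => hlo j hj _ (add_smul_single_mem_Icc hwmem hT hs)
    rw [add_smul_single_eq_update, hwj, add_sub_cancel, hw, Function.update_idem,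
      Function.update_eq_self] at h
    linarith

/-- Increment bound between two points of the box ordered coordinatewise according to `S`. -/
theorem sub_le_sum_mul_sub (hfc : ContinuousOn f (Set.Icc p q))
    (hup : ∀ j ∈ S, ∀ z ∈ Set.Icc p q, clarkeUpper f z (Pi.single j 1) ≤ ((m j : ℝ) : EReal))
    (hlo : ∀ j ∉ S, ∀ z ∈ Set.Icc p q, ((m j : ℝ) : EReal) ≤ clarkeLower f z (Pi.single j 1))
    {x y : ι → ℝ} (hx : x ∈ Set.Icc p q) (hy : y ∈ Set.Icc p q)
    (hS : ∀ j ∈ S, x j ≤ y j) (hS' : ∀ j ∉ S, y j ≤ x j) :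
    f y - f x ≤ ∑ j, m j * (y j - x j) := by
  have key : ∀ s : Finset ι, f (s.piecewise y x) - f x ≤ ∑ j ∈ s, m j * (y j - x j) := by
    intro s
    induction s using Finset.induction_on with
    | empty => simp
    | insert j s hj ih =>
      have hz : s.piecewise y x j = x j := Finset.piecewise_eq_of_notMem _ _ _ hj
      have h := update_sub_le_mul hfc hup hlo (s.piecewise_mem_Icc_of_mem_of_mem hy hx)
        ⟨hy.1 j, hy.2 j⟩ (fun h => hz.trans_le (hS j h)) (fun h => (hS' j h).trans_eq hz.symm)
      rw [hz] at h
      rw [Finset.piecewise_insert, Finset.sum_insert hj]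
      linarith
  simpa using key Finset.univ

end Box

/-- Theorem 3, part (ii): upper error bounds for the remainder-form inclusion.
The over-approximation error of `[f ζ⁻ - Δ, f ζ⁺ + Δ]` relative to the tightest
interval `[inf f, sup f]` is nonnegative and at most `min Δ (Δ + (f ζ⁺ - f ζ⁻))`
on each side. -/
theorem stmt_13 {n : ℕ} (p q : Fin n → ℝ) (hpq : p ≤ q)
    (f : (Fin n → ℝ) → ℝ) (hfc : ContinuousOn f (Set.Icc p q))
    (m : Fin n → ℝ) (S : Set (Fin n)) [DecidablePred (· ∈ S)]
    (hmS : ∀ j ∈ S, 0 ≤ m j) (hmS' : ∀ j ∉ S, m j ≤ 0)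
    (hup : ∀ j ∈ S, ∀ z ∈ Set.Icc p q,
      clarkeUpper f z (Pi.single j 1) ≤ ((m j : ℝ) : EReal))
    (hlo : ∀ j ∉ S, ∀ z ∈ Set.Icc p q,
      ((m j : ℝ) : EReal) ≤ clarkeLower f z (Pi.single j 1)) :
    let ζp : Fin n → ℝ := fun j => if j ∈ S then p j else q j
    let ζm : Fin n → ℝ := fun j => if j ∈ S then q j else p j
    let Δ : ℝ := ∑ j, m j * (ζm j - ζp j)
    let fub : ℝ := f ζp + Δ
    let flb : ℝ := f ζm - Δ
    0 ≤ Δ ∧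
    (0 ≤ fub - sSup (f '' Set.Icc p q) ∧
      fub - sSup (f '' Set.Icc p q) ≤ min Δ (Δ + (f ζp - f ζm))) ∧
    (0 ≤ sInf (f '' Set.Icc p q) - flb ∧
      sInf (f '' Set.Icc p q) - flb ≤ min Δ (Δ + (f ζp - f ζm))) := by
  intro ζp ζm Δ fub flb
  have hζp : ζp ∈ Set.Icc p q :=
    ⟨fun j => by dsimp only [ζp]; split_ifs <;> [exact le_rfl; exact hpq j],
      fun j => by dsimp only [ζp]; split_ifs <;> [exact hpq j; exact le_rfl]⟩
  have hζm : ζm ∈ Set.Icc p q :=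
    ⟨fun j => by dsimp only [ζm]; split_ifs <;> [exact hpq j; exact le_rfl],
      fun j => by dsimp only [ζm]; split_ifs <;> [exact le_rfl; exact hpq j]⟩
  have hpS : ∀ j ∈ S, ζp j = p j := fun j hj => if_pos hj
  have hpS' : ∀ j ∉ S, ζp j = q j := fun j hj => if_neg hj
  have hmmS : ∀ j ∈ S, ζm j = q j := fun j hj => if_pos hj
  have hmmS' : ∀ j ∉ S, ζm j = p j := fun j hj => if_neg hj
  have hΔ : 0 ≤ Δ := Finset.sum_nonneg fun j _ => by
    by_cases hj : j ∈ S
    · rw [hpS j hj, hmmS j hj]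
      exact mul_nonneg (hmS j hj) (sub_nonneg.2 (hpq j))
    · rw [hpS' j hj, hmmS' j hj]
      exact mul_nonneg_of_nonpos_of_nonpos (hmS' j hj) (sub_nonpos.2 (hpq j))
  have hle : ∀ z ∈ Set.Icc p q, f z ≤ fub := fun z hz => by
    have h := sub_le_sum_mul_sub hfc hup hlo hζp hz
      (fun j hj => (hpS j hj).trans_le (hz.1 j)) (fun j hj => (hz.2 j).trans_eq (hpS' j hj).symm)
    have h' : ∑ j, m j * (z j - ζp j) ≤ Δ := Finset.sum_le_sum fun j _ => by
      by_cases hj : j ∈ S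
      · rw [hmmS j hj]
        exact mul_le_mul_of_nonneg_left (sub_le_sub_right (hz.2 j) _) (hmS j hj)
      · rw [hmmS' j hj]
        exact mul_le_mul_of_nonpos_left (sub_le_sub_right (hz.1 j) _) (hmS' j hj)
    dsimp only [fub]
    linarith
  have hge : ∀ z ∈ Set.Icc p q, flb ≤ f z := fun z hz => by
    have h := sub_le_sum_mul_sub hfc hup hlo hz hζm
      (fun j hj => (hz.2 j).trans_eq (hmmS j hj).symm) (fun j hj => (hmmS' j hj).trans_le (hz.1 j))
    have h' : ∑ j, m j * (ζm j - z j) ≤ Δ := Finset.sum_le_sum fun j _ => by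
      by_cases hj : j ∈ S
      · rw [hpS j hj]
        exact mul_le_mul_of_nonneg_left (sub_le_sub_left (hz.1 j) _) (hmS j hj)
      · rw [hpS' j hj]
        exact mul_le_mul_of_nonpos_left (sub_le_sub_left (hz.2 j) _) (hmS' j hj)
    dsimp only [flb]
    linarith
  have hne : (f '' Set.Icc p q).Nonempty := ⟨f ζp, ζp, hζp, rfl⟩
  have hsup : ∀ z ∈ Set.Icc p q, f z ≤ sSup (f '' Set.Icc p q) := fun z hz =>
    le_csSup ⟨fub, Set.forall_mem_image.2 hle⟩ ⟨z, hz, rfl⟩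
  have hinf : ∀ z ∈ Set.Icc p q, sInf (f '' Set.Icc p q) ≤ f z := fun z hz =>
    csInf_le ⟨flb, Set.forall_mem_image.2 hge⟩ ⟨z, hz, rfl⟩
  have hsp := hsup ζp hζp
  have hsm := hsup ζm hζm
  have hip := hinf ζp hζp
  have him := hinf ζm hζm
  refine ⟨hΔ, ⟨sub_nonneg.2 (csSup_le hne (Set.forall_mem_image.2 hle)), le_min ?_ ?_⟩,
    sub_nonneg.2 (le_csInf hne (Set.forall_mem_image.2 hge)), le_min ?_ ?_⟩ <;>
  · dsimp only [fub, flb]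
    linarith
end

section
/- Linear convergence of the remainder-form inclusion function (Theorem 4, convergence-rate part): Let n ≥ 1, and assume the hypotheses: p ≤ q in Fin n → ℝ, f : (Fin n → ℝ) → ℝ continuous on Set.Icc p q, m : Fin n → ℝ, S ⊆ Fin n with m j ≥ 0 for j ∈ S and m j ≤ 0 for j ∉ S, and for every z ∈ Set.Icc p q: f°(z, Pi.single j 1) ≤ (m j : EReal) for j ∈ S and f_○(z, Pi.single j 1) ≥ (m j : EReal) for j ∉ S. With ζ⁺ j := if j ∈ S then p j else q j, ζ⁻ j := if j ∈ S then q j else p j, Δ := ∑ j, m j * (ζ⁻ j - ζ⁺ j), f̄ := f ζ⁺ + Δ and f̲ := f ζ⁻ - Δ, one has max (f̄ - sSup (f '' Set.Icc p q)) (sInf (f '' Set.Icc p q) - f̲) ≤ (∑ j, |m j|) * (⨆ j, (q j - p j)), where ⨆ j, (q j - p j) is the ℓ∞-diameter of the box. In particular the over-approximation error of the remainder-form inclusion function converges to zero at least linearly as the diameter of the domain interval goes to zero, with rate constant β = ∑ j, |m j|. -/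
/-- Theorem 4 (convergence-rate part): the over-approximation error of the
remainder-form inclusion function is at most `(∑ j, |m j|)` times the ℓ∞-diameter
of the box, i.e., it converges to zero at least linearly in the diameter. -/
theorem stmt_14 {n : ℕ} (hn : 1 ≤ n) (p q : Fin n → ℝ) (hpq : p ≤ q)
    (f : (Fin n → ℝ) → ℝ) (hfc : ContinuousOn f (Set.Icc p q))
    (m : Fin n → ℝ) (S : Set (Fin n)) [DecidablePred (· ∈ S)]
    (hmS : ∀ j ∈ S, 0 ≤ m j) (hmS' : ∀ j ∉ S, m j ≤ 0)
    (hup : ∀ j ∈ S, ∀ z ∈ Set.Icc p q,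
      clarkeUpper f z (Pi.single j 1) ≤ ((m j : ℝ) : EReal))
    (hlo : ∀ j ∉ S, ∀ z ∈ Set.Icc p q,
      ((m j : ℝ) : EReal) ≤ clarkeLower f z (Pi.single j 1)) :
    let ζp : Fin n → ℝ := fun j => if j ∈ S then p j else q j
    let ζm : Fin n → ℝ := fun j => if j ∈ S then q j else p j
    let Δ : ℝ := ∑ j, m j * (ζm j - ζp j)
    let fub : ℝ := f ζp + Δ
    let flb : ℝ := f ζm - Δ
    max (fub - sSup (f '' Set.Icc p q)) (sInf (f '' Set.Icc p q) - flb) ≤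
      (∑ j, |m j|) * (⨆ j, (q j - p j)) := by
  intro ζp ζm Δ fub flb
  have hζp : ζp ∈ Set.Icc p q := by
    constructor <;> intro j <;> by_cases hj : j ∈ S <;> simp [ζp, hj, hpq j]
  have hζm : ζm ∈ Set.Icc p q := by
    constructor <;> intro j <;> by_cases hj : j ∈ S <;> simp [ζm, hj, hpq j]
  have himage : IsCompact (f '' Set.Icc p q) := isCompact_Icc.image_of_continuousOn hfc
  have hsup : f ζp ≤ sSup (f '' Set.Icc p q) :=
    le_csSup himage.bddAbove (Set.mem_image_of_mem f hζp)
  have hinf : sInf (f '' Set.Icc p q) ≤ f ζm :=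
    csInf_le himage.bddBelow (Set.mem_image_of_mem f hζm)
  have hΔ : Δ ≤ (∑ j, |m j|) * (⨆ j, (q j - p j)) := by
    rw [Finset.sum_mul]
    refine Finset.sum_le_sum fun j _ => ?_
    have hterm : m j * (ζm j - ζp j) = |m j| * (q j - p j) := by
      by_cases hj : j ∈ S
      · simp [ζm, ζp, hj, abs_of_nonneg (hmS j hj)]
      · simp only [ζm, ζp, hj, if_false, abs_of_nonpos (hmS' j hj)]
        ring
    rw [hterm]
    exact mul_le_mul_of_nonneg_left
      (le_ciSup (f := fun j => q j - p j) (Set.finite_range _).bddAbove j) (abs_nonneg _)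
  refine max_le ?_ ?_ <;> simp only [fub, flb] <;> linarith
end

section
/- The Yang–Ozay construction yields a mixed-monotone decomposition function (Proposition 2, discrete-time, scalar case): Let p ≤ q in Fin n → ℝ (componentwise), let U be an open set containing Set.Icc p q, let f : (Fin n → ℝ) → ℝ be differentiable on U, and let a, b : Fin n → ℝ satisfy a j ≤ fderiv ℝ f z (Pi.single j 1) ≤ b j for all z ∈ Set.Icc p q and all j. Define the coefficient c : Fin n → ℝ by c j := 0 if a j ≥ 0 or b j ≤ 0; c j := |a j| if a j < 0 and b j > 0 and |a j| ≤ |b j|; and c j := |b j| if a j < 0 and b j > 0 and |b j| < |a j|; and define the selection ζ : (Fin n → ℝ) → (Fin n → ℝ) → (Fin n → ℝ) by (ζ z ẑ) j := z j if (a j ≥ 0) or (a j < 0 and b j > 0 and |a j| ≤ |b j|), and (ζ z ẑ) j := ẑ j otherwise. Define f^L_d z ẑ := f (ζ z ẑ) + ∑ j, c j * (z j - ẑ j). Then: (i) f^L_d z z = f z for all z; (ii) for all z, z', ẑ ∈ Set.Icc p q with z ≤ z', f^L_d z ẑ ≤ f^L_d z' ẑ; (iii) for all z, ẑ, ẑ'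 ∈ Set.Icc p q with ẑ ≤ ẑ', f^L_d z ẑ' ≤ f^L_d z ẑ; and consequently (iv) for all z̲, z, z̄ ∈ Set.Icc p q with z̲ ≤ z ≤ z̄, f^L_d z̲ z̄ ≤ f z ≤ f^L_d z̄ z̲. -/
/-- Mean value theorem on a convex set, in terms of partial derivatives. -/
theorem exists_sub_eq_sum_fderiv_single {ι : Type*} [Fintype ι] [DecidableEq ι]
    {f : (ι → ℝ) → ℝ} {s : Set (ι → ℝ)} (hs : Convex ℝ s)
    (hf : ∀ z ∈ s, DifferentiableAt ℝ f z) {x y : ι → ℝ} (hx : x ∈ s) (hy : y ∈ s) :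
    ∃ w ∈ s, f y - f x = ∑ j, fderiv ℝ f w (Pi.single j 1) * (y j - x j) := by
  obtain ⟨w, hw, h⟩ := domain_mvt
    (fun z hz => (hf z hz).hasFDerivAt.hasFDerivWithinAt) hs hx hy
  refine ⟨w, hs.segment_subset hx hy hw, h.trans ?_⟩
  conv_lhs => rw [pi_eq_sum_univ' (y - x), map_sum]
  refine Finset.sum_congr rfl fun j _ => ?_
  rw [map_smul, smul_eq_mul, Pi.sub_apply, mul_comm]

open Classical in
/-- Proposition 2 (Yang–Ozay construction, discrete-time, scalar case): given
per-coordinate derivative bounds `a j ≤ ∂f/∂z j ≤ b j` on the box, the function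
`f^L_d z ẑ = f (ζ z ẑ) + ∑ j, c j * (z j - ẑ j)` is a mixed-monotone decomposition
function for `f` on the box. -/
theorem stmt_15 {n : ℕ} (p q : Fin n → ℝ) (hpq : p ≤ q)
    (U : Set (Fin n → ℝ)) (hU : IsOpen U) (hUpq : Set.Icc p q ⊆ U)
    (f : (Fin n → ℝ) → ℝ) (hf : DifferentiableOn ℝ f U)
    (a b : Fin n → ℝ)
    (hab : ∀ z ∈ Set.Icc p q, ∀ j : Fin n,
      a j ≤ fderiv ℝ f z (Pi.single j 1) ∧ fderiv ℝ f z (Pi.single j 1) ≤ b j) :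
    let c : Fin n → ℝ := fun j =>
      if 0 ≤ a j ∨ b j ≤ 0 then 0
      else if |a j| ≤ |b j| then |a j| else |b j|
    let ζ : (Fin n → ℝ) → (Fin n → ℝ) → (Fin n → ℝ) := fun z zh => fun j =>
      if 0 ≤ a j ∨ (a j < 0 ∧ 0 < b j ∧ |a j| ≤ |b j|) then z j else zh j
    let fL : (Fin n → ℝ) → (Fin n → ℝ) → ℝ := fun z zh =>
      f (ζ z zh) + ∑ j, c j * (z j - zh j)
    (∀ z, fL z z = f z) ∧
    (∀ z z' zh, z ∈ Set.Icc p q → z' ∈ Set.Icc p q → zh ∈ Set.Icc p q →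
      z ≤ z' → fL z zh ≤ fL z' zh) ∧
    (∀ z zh zh', z ∈ Set.Icc p q → zh ∈ Set.Icc p q → zh' ∈ Set.Icc p q →
      zh ≤ zh' → fL z zh' ≤ fL z zh) ∧
    (∀ zl z zu, zl ∈ Set.Icc p q → z ∈ Set.Icc p q → zu ∈ Set.Icc p q →
      zl ≤ z → z ≤ zu → fL zl zu ≤ f z ∧ f z ≤ fL zu zl) := by
  intro c ζ fL
  have hζ : ∀ z zh, z ∈ Set.Icc p q → zh ∈ Set.Icc p q → ζ z zh ∈ Set.Icc p q := by
    intro z zh hz hzh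
    constructor <;> intro j <;> dsimp only [ζ] <;> split_ifs
    exacts [hz.1 j, hzh.1 j, hz.2 j, hzh.2 j]
  have hdiff : ∀ z ∈ Set.Icc p q, DifferentiableAt ℝ f z := fun z hz =>
    hf.differentiableAt (hU.mem_nhds (hUpq hz))
  have hdiag : ∀ z, fL z z = f z := by
    intro z
    have h : ζ z z = z := by
      ext j
      simp [ζ]
    simp [fL, h]
  have hmono : ∀ z z' zh zh', z ∈ Set.Icc p q → z' ∈ Set.Icc p q → zh ∈ Set.Icc p q →
      zh' ∈ Set.Icc p q → z ≤ z' → zh' ≤ zh → fL z zh ≤ fL z' zh' := by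
    intro z z' zh zh' hz hz' hzh hzh' hle hle'
    obtain ⟨w, hw, h⟩ := exists_sub_eq_sum_fderiv_single (convex_Icc p q) hdiff
      (hζ z zh hz hzh) (hζ z' zh' hz' hzh')
    have key : 0 ≤ ∑ j, (fderiv ℝ f w (Pi.single j 1) * (ζ z' zh' j - ζ z zh j)
        + (c j * (z' j - zh' j) - c j * (z j - zh j))) := by
      refine Finset.sum_nonneg fun j _ => ?_
      obtain ⟨ha, hb⟩ := hab w hw j
      generalize fderiv ℝ f w (Pi.single j 1) = d at ha hb
      have h1 := sub_nonneg.2 (hle j)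
      have h2 := sub_nonneg.2 (hle' j)
      dsimp only [c, ζ]
      rcases le_or_gt 0 (a j) with h0 | h0
      · rw [if_pos (Or.inl h0), if_pos (Or.inl h0), if_pos (Or.inl h0)]
        nlinarith [mul_nonneg (h0.trans ha) h1]
      rcases le_or_gt (b j) 0 with h3 | h3
      · have hn : ¬(0 ≤ a j ∨ (a j < 0 ∧ 0 < b j ∧ |a j| ≤ |b j|)) := by
          rintro (h | h)
          exacts [h.not_gt h0, h.2.1.not_ge h3]
        rw [if_neg hn, if_neg hn, if_pos (Or.inr h3)]
        nlinarith [mul_nonneg (sub_nonneg.2 (hb.trans h3)) h2]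
      have hn : ¬(0 ≤ a j ∨ b j ≤ 0) := by
        rintro (h | h)
        exacts [h.not_gt h0, h.not_gt h3]
      rw [if_neg hn]
      by_cases h4 : |a j| ≤ |b j|
      · have hp : 0 ≤ a j ∨ (a j < 0 ∧ 0 < b j ∧ |a j| ≤ |b j|) := Or.inr ⟨h0, h3, h4⟩
        rw [if_pos hp, if_pos hp, if_pos h4, abs_of_neg h0]
        nlinarith [mul_nonneg (sub_nonneg.2 ha) h1, mul_nonneg (neg_nonneg.2 h0.le) h2]
      · have hn' : ¬(0 ≤ a j ∨ (a j < 0 ∧ 0 < b j ∧ |a j| ≤ |b j|)) := by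
          rintro (h | h)
          exacts [h.not_gt h0, h4 h.2.2]
        rw [if_neg hn', if_neg hn', if_neg h4, abs_of_pos h3]
        nlinarith [mul_nonneg (sub_nonneg.2 hb) h2, mul_nonneg h3.le h1]
    rw [Finset.sum_add_distrib, Finset.sum_sub_distrib, ← h] at key
    dsimp only [fL]
    linarith
  refine ⟨hdiag, fun z z' zh hz hz' hzh hle => hmono _ _ _ _ hz hz' hzh hzh hle le_rfl,
    fun z zh zh' hz hzh hzh' hle => hmono _ _ _ _ hz hz hzh' hzh le_rfl hle,
    fun zl z zu hl hz hu h1 h2 => ⟨?_, ?_⟩⟩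
  · exact (hmono _ _ _ _ hl hz hu hz h1 h2).trans_eq (hdiag z)
  · exact (hdiag z).symm.trans_le (hmono _ _ _ _ hz hu hz hl h2 h1)
end

section
/- The Yang–Ozay decomposition function belongs to the remainder-form family (Theorem 5, part (i)): Let a, b : Fin n → ℝ with a j ≤ b j for all j. Define m^L : Fin n → ℝ by m^L j := 0 if a j ≥ 0 or b j ≤ 0; m^L j := a j if a j < 0 and b j > 0 and |a j| ≤ |b j|; m^L j := b j if a j < 0 and b j > 0 and |b j| < |a j|. Define c : Fin n → ℝ by c j := 0 in the first case, |a j| in the second, and |b j| in the third, and define ζ : (Fin n → ℝ) → (Fin n → ℝ) → (Fin n → ℝ) by (ζ z ẑ) j := z j if (a j ≥ 0) or (a j < 0 and b j > 0 and |a j| ≤ |b j|), and (ζ z ẑ) j := ẑ j otherwise. Then: (i) for every j, m^L j = max (b j) 0 or m^L j = min (a j) 0 (so m^L belongs to the finite set of supporting vectors M^c); and (ii) for every f : (Fin n → ℝ) → ℝ and all z, ẑ : Fin n → ℝ, (∑ j, m^L j * (ζ ẑ z) j) + f (ζ z ẑ) - (∑ j, m^L j * (ζ z ẑ) j) = f (ζ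 z ẑ) + ∑ j, c j * (z j - ẑ j); i.e., the remainder-form decomposition function with supporting vector m^L and linear remainder h(w) = ∑ j, m^L j * w j equals the Yang–Ozay decomposition function f^L_d z ẑ = f (ζ z ẑ) + ∑ j, c j * (z j - ẑ j). -/
open Classical in
/-- Theorem 5, part (i): the Yang–Ozay decomposition function belongs to the
remainder-form family: its supporting vector `m^L` lies in the finite set `M^c`
(`m^L j ∈ {max (b j) 0, min (a j) 0}` for every `j`), and the remainder-form
decomposition function with supporting vector `m^L` and linear remainder
`h w = ∑ j, m^L j * w j` coincides with the Yang–Ozay decomposition function. -/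
theorem stmt_16 {n : ℕ} (a b : Fin n → ℝ) (hab : ∀ j, a j ≤ b j) :
    let mL : Fin n → ℝ := fun j =>
      if 0 ≤ a j ∨ b j ≤ 0 then 0
      else if |a j| ≤ |b j| then a j else b j
    let c : Fin n → ℝ := fun j =>
      if 0 ≤ a j ∨ b j ≤ 0 then 0
      else if |a j| ≤ |b j| then |a j| else |b j|
    let ζ : (Fin n → ℝ) → (Fin n → ℝ) → (Fin n → ℝ) := fun z zh => fun j =>
      if 0 ≤ a j ∨ (a j < 0 ∧ 0 < b j ∧ |a j| ≤ |b j|) then z j else zh j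
    (∀ j : Fin n, mL j = max (b j) 0 ∨ mL j = min (a j) 0) ∧
    (∀ f : (Fin n → ℝ) → ℝ, ∀ z zh : Fin n → ℝ,
      (∑ j, mL j * (ζ zh z) j) + f (ζ z zh) - (∑ j, mL j * (ζ z zh) j) =
        f (ζ z zh) + ∑ j, c j * (z j - zh j)) := by
  intro mL c ζ
  constructor
  · intro j
    simp only [mL]
    split_ifs with h h'
    · rcases h with h | h
      · exact Or.inr (min_eq_right h).symm
      · exact Or.inl (max_eq_right h).symm
    · push Not at h
      exact Or.inr (min_eq_left h.1.le).symm
    · push Not at h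
      exact Or.inl (max_eq_left h.2.le).symm
  · intro f z zh
    have key : (∑ j, mL j * (ζ zh z) j) - (∑ j, mL j * (ζ z zh) j) =
        ∑ j, c j * (z j - zh j) := by
      rw [← Finset.sum_sub_distrib]
      refine Finset.sum_congr rfl fun j _ => ?_
      simp only [mL, c, ζ]
      by_cases h : 0 ≤ a j ∨ b j ≤ 0
      · simp [h]
      · have ⟨ha, hb⟩ : a j < 0 ∧ 0 < b j := by simpa using h
        by_cases h' : |a j| ≤ |b j|
        · have hζ : 0 ≤ a j ∨ (a j < 0 ∧ 0 < b j ∧ |a j| ≤ |b j|) := Or.inr ⟨ha, hb, h'⟩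
          rw [if_neg h, if_neg h, if_pos h', if_pos h', if_pos hζ, if_pos hζ, abs_of_neg ha]
          ring
        · have hζ : ¬(0 ≤ a j ∨ (a j < 0 ∧ 0 < b j ∧ |a j| ≤ |b j|)) := by
            rintro (h₀ | h₀)
            · exact ha.not_ge h₀
            · exact h' h₀.2.2
          rw [if_neg h, if_neg h, if_neg h', if_neg h', if_neg hζ, if_neg hζ, abs_of_pos hb]
          ring
    linarith
end

section
/- The tightest remainder-form decomposition function is at least as tight as the Yang–Ozay decomposition function (Theorem 5, part (ii)): Let a, b : Fin n → ℝ with a j ≤ b j for all j, and let f : (Fin n → ℝ) → ℝ. For a selection s : Fin n → Bool define m^s j := if s j then max (b j) 0 else min (a j) 0 and (ζ^s z ẑ) j := if s j then ẑ j else z j. Let c and ζ be as in the Yang–Ozay construction: c j := 0 if a j ≥ 0 or b j ≤ 0, c j := |a j| if a j < 0 < b j and |a j| ≤ |b j|, c j := |b j| if a j < 0 < b j and |b j| < |a j|; (ζ z ẑ) j := z j if (a j ≥ 0) or (a j < 0 < b j and |a j| ≤ |b j|), else ẑ j; and f^L_d z ẑ := f (ζ z ẑ) + ∑ j, c j * (z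 j - ẑ j). Then for all z, ẑ : Fin n → ℝ with ẑ ≤ z: there exists a selection s such that f (ζ^s z ẑ) + ∑ j, m^s j * ((ζ^s ẑ z) j - (ζ^s z ẑ) j) ≤ f^L_d z ẑ, and there exists a selection s' such that f (ζ^{s'} ẑ z) + ∑ j, m^{s'} j * ((ζ^{s'} z ẑ) j - (ζ^{s'} ẑ z) j) ≥ f^L_d ẑ z; hence the minimum over all selections of the remainder-form upper values is at most f^L_d z ẑ and the maximum of the remainder-form lower values is at least f^L_d ẑ z, so the optimal remainder-form inclusion is at least as tight as the inclusion induced by f^L_d. -/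
open Classical in
/-- Theorem 5, part (ii): the tightest remainder-form decomposition function is at
least as tight as the Yang–Ozay decomposition function `f^L_d`: for `ẑ ≤ z`, some
selection `s` of supporting vectors gives a remainder-form upper value at most
`f^L_d z ẑ`, and some selection gives a remainder-form lower value at least
`f^L_d ẑ z`. -/
theorem stmt_17 {n : ℕ} (a b : Fin n → ℝ) (hab : ∀ j, a j ≤ b j)
    (f : (Fin n → ℝ) → ℝ) :
    let mS : (Fin n → Bool) → Fin n → ℝ := fun s j =>
      if s j then max (b j) 0 else min (a j) 0
    let ζS : (Fin n → Bool) → (Fin n → ℝ) → (Fin n → ℝ) → (Fin n → ℝ) :=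
      fun s z zh => fun j => if s j then zh j else z j
    let c : Fin n → ℝ := fun j =>
      if 0 ≤ a j ∨ b j ≤ 0 then 0
      else if |a j| ≤ |b j| then |a j| else |b j|
    let ζ : (Fin n → ℝ) → (Fin n → ℝ) → (Fin n → ℝ) := fun z zh => fun j =>
      if 0 ≤ a j ∨ (a j < 0 ∧ 0 < b j ∧ |a j| ≤ |b j|) then z j else zh j
    let fL : (Fin n → ℝ) → (Fin n → ℝ) → ℝ := fun z zh =>
      f (ζ z zh) + ∑ j, c j * (z j - zh j)
    ∀ z zh : Fin n → ℝ, zh ≤ z →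
      (∃ s : Fin n → Bool,
        f (ζS s z zh) + ∑ j, mS s j * ((ζS s zh z) j - (ζS s z zh) j) ≤ fL z zh) ∧
      (∃ s' : Fin n → Bool,
        fL zh z ≤ f (ζS s' zh z) + ∑ j, mS s' j * ((ζS s' z zh) j - (ζS s' zh z) j)) := by
  intro mS ζS c ζ fL
  let s : Fin n → Bool := fun j =>
    decide (¬ (0 ≤ a j ∨ (a j < 0 ∧ 0 < b j ∧ |a j| ≤ |b j|)))
  have key : ∀ z zh : Fin n → ℝ,
      f (ζS s z zh) + ∑ j, mS s j * ((ζS s zh z) j - (ζS s z zh) j) = fL z zh := by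
    intro z zh
    have hζ : ζS s z zh = ζ z zh := by
      funext j
      by_cases h : 0 ≤ a j ∨ (a j < 0 ∧ 0 < b j ∧ |a j| ≤ |b j|)
      · simp only [ζS, ζ, s, h, not_true_eq_false, decide_false, Bool.false_eq_true,
          if_true, if_false]
      · simp only [ζS, ζ, s, h, not_false_eq_true, decide_true, if_true, if_false]
    have hsum : ∀ j, mS s j * ((ζS s zh z) j - (ζS s z zh) j) = c j * (z j - zh j) := by
      intro j
      by_cases h : 0 ≤ a j ∨ (a j < 0 ∧ 0 < b j ∧ |a j| ≤ |b j|)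
      · simp only [mS, ζS, c, s, h, not_true_eq_false, decide_false, Bool.false_eq_true,
          if_false]
        rcases h with ha | ⟨ha, hb, hle⟩
        · simp [ha]
        · rw [if_neg (by simp [ha, hb]), if_pos hle, min_eq_left ha.le, abs_of_neg ha]
          ring
      · simp only [mS, ζS, c, s, h, not_false_eq_true, decide_true, if_true]
        push Not at h
        obtain ⟨ha, h⟩ := h
        rcases le_or_gt (b j) 0 with hb | hb
        · simp [hb]
        · rw [if_neg (by simp [ha, hb]), if_neg (h ha hb).not_ge, max_eq_left hb.le,
            abs_of_pos hb]
    rw [Finset.sum_congr rfl fun j _ => hsum j, hζ]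
  exact fun z zh _ => ⟨⟨s, (key z zh).le⟩, ⟨s, (key zh z).ge⟩⟩
end
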